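/- Let {x_k}_{k=1}^∞ be a frame for the real Hilbert space ℓ₂. The following are equivalent: (1) for every real sequence a = (a_1, a_2, …) ∈ ℓ₁ there is a Hilbert–Schmidt self-adjoint operator T on ℓ₂ with ⟨T x_k, x_k⟩ = a_k for all k = 1, 2, …; (2) there exists δ > 0 such that the sequence {x̃_k}_{k=1}^∞ is δ-separated in H̃. -/

import Mathlib

open scoped InnerProductSpace

/-- The real Hilbert space `ℓ₂`. -/
abbrev ell2 : Type := lp (fun _ : ℕ => ℝ) 2

/-- `H̃`, the `ℓ₂` direct sum of countably many copies of the real `ℓ₂`. -/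
abbrev Htilde : Type := lp (fun _ : ℕ => ell2) 2

/-- `T` is a Hilbert–Schmidt operator on `ℓ₂`: `Σ_i ‖T e_i‖² < ∞` for the
canonical orthonormal basis `{e_i}`. -/
def IsHilbertSchmidt (T : ell2 →L[ℝ] ell2) : Prop :=
  Summable fun i : ℕ => ‖T (lp.single 2 i (1 : ℝ))‖ ^ 2

/-- A sequence `{y_k}` is `δ`-separated if for every `j`, the distance from
`y_j` to the closed linear span of `{y_i}_{i ≠ j}` is at least `δ`
(equivalently, `‖(I − P_j) y_j‖ ≥ δ` for the orthogonal projection `P_j` onto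
that span). -/
def IsDeltaSeparated {E : Type} [NormedAddCommGroup E] [InnerProductSpace ℝ E]
    (δ : ℝ) (y : ℕ → E) : Prop :=
  ∀ j : ℕ, ∀ v ∈ Submodule.span ℝ (y '' {i | i ≠ j}), δ ≤ ‖y j - v‖

/-- unit vectors -/
noncomputable def bas (i : ℕ) : ell2 := lp.single 2 i (1 : ℝ)

lemma bas_apply (i j : ℕ) : bas i j = if j = i then 1 else 0 := by
  unfold bas
  by_cases h : j = i
  · subst h; simp
  · simp [h]

lemma inner_bas_left (i : ℕ) (v : ell2) : ⟪bas i, v⟫_ℝ = v i := by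
  unfold bas
  rw [lp.inner_single_left]; simp

lemma inner_bas_right (i : ℕ) (v : ell2) : ⟪v, bas i⟫_ℝ = v i := by
  rw [real_inner_comm, inner_bas_left]

lemma hasSum_sq {E : ℕ → Type} [∀ i, NormedAddCommGroup (E i)] (f : lp E 2) :
    HasSum (fun i => ‖f i‖ ^ 2) (‖f‖ ^ 2) := by
  have := lp.hasSum_norm (p := 2) (by norm_num) f
  simpa using this

lemma mem_two {E : ℕ → Type} [∀ i, NormedAddCommGroup (E i)] {f : ∀ i, E i}
    (h : Summable fun i => ‖f i‖ ^ 2) : Memℓp f 2 := by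
  apply memℓp_gen
  simpa using h

lemma hs_adjoint {T : ell2 →L[ℝ] ell2} (h : IsHilbertSchmidt T) :
    IsHilbertSchmidt (ContinuousLinearMap.adjoint T) := by
  change Summable fun i : ℕ => ‖T (bas i)‖ ^ 2 at h
  change Summable fun i : ℕ => ‖ContinuousLinearMap.adjoint T (bas i)‖ ^ 2
  have e1 : ∀ i k, (ContinuousLinearMap.adjoint T (bas i)) k = T (bas k) i := by
    intro i k
    rw [← inner_bas_right, ContinuousLinearMap.adjoint_inner_left, inner_bas_left]
  have h1 : Summable fun p : ℕ × ℕ => ‖T (bas p.1) p.2‖ ^ 2 := by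
    rw [summable_prod_of_nonneg (fun p => by positivity)]
    refine ⟨fun k => (hasSum_sq (T (bas k))).summable, ?_⟩
    simpa only [(hasSum_sq (T (bas _))).tsum_eq] using h
  have h2 := h1.prod_symm
  rw [summable_prod_of_nonneg (fun p => by positivity)] at h2
  refine h2.2.congr fun i => ?_
  rw [← (hasSum_sq _).tsum_eq]
  simp only [e1, Prod.fst_swap, Prod.snd_swap]

/-- shift -/
noncomputable def sh (i : ℕ) (w : ell2) : ell2 :=
  ⟨fun j => w (i + j), mem_two ((hasSum_sq w).summable.comp_injective (add_right_injective i))⟩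

lemma sh_apply (i : ℕ) (w : ell2) (j : ℕ) : sh i w j = w (i + j) := rfl

lemma sh_norm (i : ℕ) (w : ell2) : ‖sh i w‖ ≤ ‖w‖ := by
  refine (sq_le_sq₀ (norm_nonneg _) (norm_nonneg _)).1 ?_
  rw [← (hasSum_sq w).tsum_eq, ← (hasSum_sq (sh i w)).tsum_eq]
  exact tsum_comp_le_tsum_of_inj (hasSum_sq w).summable (fun _ => by positivity)
    (add_right_injective i)

lemma S_bound (u : Htilde) (w : ell2) (i : ℕ) :
    ‖⟪u i, sh i w⟫_ℝ‖ ^ 2 ≤ ‖u i‖ ^ 2 * ‖w‖ ^ 2 := by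
  rw [← mul_pow]
  gcongr
  exact (norm_inner_le_norm _ _).trans (by gcongr; exact sh_norm i w)

/-- underlying function of the operator -/
noncomputable def Sfun (u : Htilde) (w : ell2) : ell2 :=
  ⟨fun i => ⟪u i, sh i w⟫_ℝ, mem_two
    (Summable.of_nonneg_of_le (fun _ => by positivity) (S_bound u w)
      ((hasSum_sq u).summable.mul_right _))⟩

lemma Sfun_apply (u : Htilde) (w : ell2) (i : ℕ) : Sfun u w i = ⟪u i, sh i w⟫_ℝ := rfl

lemma Sfun_norm (u : Htilde) (w : ell2) : ‖Sfun u w‖ ≤ ‖u‖ * ‖w‖ := by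
  refine (sq_le_sq₀ (norm_nonneg _) (by positivity)).1 ?_
  rw [mul_pow]
  refine hasSum_le (fun i => ?_) (hasSum_sq (Sfun u w)) ((hasSum_sq u).mul_right (‖w‖ ^ 2))
  rw [Sfun_apply]
  exact S_bound u w i

/-- operator with upper triangular matrix u -/
noncomputable def Sop (u : Htilde) : ell2 →L[ℝ] ell2 :=
  LinearMap.mkContinuous
    { toFun := Sfun u
      map_add' := fun v w => by
        ext i
        change ⟪u i, sh i (v + w)⟫_ℝ = ⟪u i, sh i v⟫_ℝ + ⟪u i, sh i w⟫_ℝ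
        rw [← inner_add_right]; rfl
      map_smul' := fun c w => by
        ext i
        change ⟪u i, sh i (c • w)⟫_ℝ = c * ⟪u i, sh i w⟫_ℝ
        rw [← real_inner_smul_right]; rfl } ‖u‖ (Sfun_norm u)

lemma Sop_apply (u : Htilde) (w : ell2) (i : ℕ) : Sop u w i = ⟪u i, sh i w⟫_ℝ := rfl

lemma Sop_inner (u y : Htilde) (x : ell2) (hy : ∀ i j, y i j = x i * x (i + j)) :
    ⟪Sop u x, x⟫_ℝ = ⟪u, y⟫_ℝ := by
  rw [lp.inner_eq_tsum, lp.inner_eq_tsum]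
  congr 1
  ext i
  have : y i = x i • sh i x := by
    ext j; exact hy i j
  rw [this, real_inner_smul_right, Sop_apply]
  rfl

lemma Sop_adj_hs (u : Htilde) : IsHilbertSchmidt (ContinuousLinearMap.adjoint (Sop u)) := by
  change Summable fun i : ℕ => ‖ContinuousLinearMap.adjoint (Sop u) (bas i)‖ ^ 2
  refine Summable.of_nonneg_of_le (fun _ => by positivity) (fun i => ?_) (hasSum_sq u).summable
  gcongr
  set z := ContinuousLinearMap.adjoint (Sop u) (bas i) with hz
  have h : ‖z‖ * ‖z‖ ≤ ‖u i‖ * ‖z‖ := by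
    rw [← real_inner_self_eq_norm_mul_norm]
    nth_rw 1 [hz]
    rw [ContinuousLinearMap.adjoint_inner_left, inner_bas_left, Sop_apply]
    exact (real_inner_le_norm _ _).trans (by gcongr; exact sh_norm i z)
  by_cases h0 : ‖z‖ = 0
  · rw [h0]; positivity
  · exact le_of_mul_le_mul_right h (lt_of_le_of_ne (norm_nonneg _) (Ne.symm h0))

lemma hs_half {S T : ell2 →L[ℝ] ell2} (hS : IsHilbertSchmidt S) (hT : IsHilbertSchmidt T) :
    IsHilbertSchmidt ((1 / 2 : ℝ) • (S + T)) := by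
  refine Summable.of_nonneg_of_le (fun _ => by positivity) (fun i => ?_) (hS.add hT)
  simp only [ContinuousLinearMap.smul_apply, ContinuousLinearMap.add_apply, norm_smul]
  have := norm_add_le (S (lp.single 2 i (1 : ℝ))) (T (lp.single 2 i (1 : ℝ)))
  have h3 := norm_nonneg (S (lp.single 2 i (1 : ℝ)) + T (lp.single 2 i (1 : ℝ)))
  generalize ‖S (lp.single 2 i (1 : ℝ)) + T (lp.single 2 i (1 : ℝ))‖ = c at *
  generalize ‖S (lp.single 2 i (1 : ℝ))‖ = a at *
  generalize ‖T (lp.single 2 i (1 : ℝ))‖ = b at *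
  norm_num
  nlinarith [sq_nonneg (a - b), sq_nonneg a, sq_nonneg b, mul_self_le_mul_self h3 this]

lemma half_inner (S : ell2 →L[ℝ] ell2) (x : ell2) :
    ⟪((1 / 2 : ℝ) • (S + ContinuousLinearMap.adjoint S)) x, x⟫_ℝ = ⟪S x, x⟫_ℝ := by
  simp only [ContinuousLinearMap.smul_apply, ContinuousLinearMap.add_apply,
    real_inner_smul_left, inner_add_left, ContinuousLinearMap.adjoint_inner_left]
  rw [real_inner_comm x (S x)]; ring

lemma exists_T (u : Htilde) : ∃ T : ell2 →L[ℝ] ell2, IsHilbertSchmidt T ∧ IsSelfAdjoint T ∧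
    ∀ x : ell2, ⟪T x, x⟫_ℝ = ⟪Sop u x, x⟫_ℝ := by
  refine ⟨(1 / 2 : ℝ) • (Sop u + ContinuousLinearMap.adjoint (Sop u)), ?_, ?_, half_inner _⟩
  · refine hs_half ?_ (Sop_adj_hs u)
    have := hs_adjoint (Sop_adj_hs u)
    rwa [ContinuousLinearMap.adjoint_adjoint] at this
  · rw [ContinuousLinearMap.isSelfAdjoint_iff_isSymmetric]
    intro v w
    simp only [ContinuousLinearMap.coe_coe, ContinuousLinearMap.smul_apply,
      ContinuousLinearMap.add_apply, real_inner_smul_left, real_inner_smul_right,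
      inner_add_left, inner_add_right, ContinuousLinearMap.adjoint_inner_left,
      ContinuousLinearMap.adjoint_inner_right]
    ring

lemma Sop_bas (u : Htilde) (k l : ℕ) : Sop u (bas k) l = if l ≤ k then u l (k - l) else 0 := by
  rw [Sop_apply]
  split_ifs with h
  · have : sh l (bas k) = bas (k - l) := by
      ext j
      rw [sh_apply, bas_apply, bas_apply]
      congr 1
      apply propext
      omega
    rw [this, inner_bas_right]
  · have : sh l (bas k) = 0 := by
      ext j
      rw [sh_apply, bas_apply, if_neg (by omega)]; rfl
    rw [this, inner_zero_right]

lemma ext_bas {S T : ell2 →L[ℝ] ell2} (h : ∀ k l, S (bas k) l = T (bas k) l) : S = T := by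
  ext v : 1
  have hv : HasSum (fun k => v k • bas k) v := by
    have := lp.hasSum_single (p := 2) (by norm_num) v
    convert this using 2 with k
    unfold bas
    rw [← lp.single_smul]; simp
  have h1 := hv.mapL S
  have h2 := hv.mapL T
  have : ∀ k, S (bas k) = T (bas k) := fun k => by ext l; exact h k l
  simp only [map_smul, this] at h1 h2
  exact h1.unique h2

lemma exists_u {T : ell2 →L[ℝ] ell2} (hT : IsHilbertSchmidt T) (hs : IsSelfAdjoint T) :
    ∃ u : Htilde, ∀ x : ell2, ⟪T x, x⟫_ℝ = ⟪Sop u x, x⟫_ℝ := by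
  have hsym : ∀ k l, T (bas k) l = T (bas l) k := by
    intro k l
    have := (ContinuousLinearMap.isSelfAdjoint_iff_isSymmetric.1 hs) (bas k) (bas l)
    simpa [inner_bas_left, inner_bas_right] using this
  let f : ℕ → ell2 := fun i => (2 : ℝ) • sh i (T (bas i)) - (T (bas i) i) • bas 0
  have hb : ∀ i, ‖bas i‖ = 1 := fun i => by unfold bas; rw [lp.norm_single (by norm_num)]; simp
  have hf : ∀ i, ‖f i‖ ^ 2 ≤ 9 * ‖T (bas i)‖ ^ 2 := by
    intro i
    have h1 : ‖f i‖ ≤ 3 * ‖T (bas i)‖ := by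
      refine (norm_sub_le _ _).trans ?_
      rw [norm_smul, norm_smul, hb]
      have a := sh_norm i (T (bas i))
      have b := lp.norm_apply_le_norm (p := 2) (by norm_num) (T (bas i)) i
      norm_num at *
      linarith
    calc _ ≤ (3 * ‖T (bas i)‖) ^ 2 := by gcongr
      _ = _ := by ring
  let u : Htilde := ⟨f, mem_two (Summable.of_nonneg_of_le (fun _ => by positivity) hf
    (Summable.mul_left 9 hT))⟩
  have hu : ∀ i j, u i j = 2 * T (bas i) (i + j) - T (bas i) i * bas 0 j := fun i j => rfl
  refine ⟨u, fun x => ?_⟩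
  rw [← half_inner (Sop u)]
  congr 2
  apply ext_bas
  intro k l
  have e1 : (ContinuousLinearMap.adjoint (Sop u) (bas k)) l = Sop u (bas l) k := by
    rw [← inner_bas_right, ContinuousLinearMap.adjoint_inner_left, inner_bas_left]
  change _ = (1 / 2 : ℝ) * (Sop u (bas k) l + (ContinuousLinearMap.adjoint (Sop u) (bas k)) l)
  rw [e1, Sop_bas, Sop_bas, hu, hu, bas_apply, bas_apply]
  rcases lt_trichotomy k l with h | h | h
  · rw [if_neg (by omega), if_pos (by omega), if_neg (by omega), Nat.add_sub_cancel' h.le]; ring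
  · subst h; simp; ring
  · rw [if_pos (by omega), if_neg (by omega), if_neg (by omega), Nat.add_sub_cancel' h.le,
      hsym l k]; ring

lemma exists_dual {E : Type} [NormedAddCommGroup E] [InnerProductSpace ℝ E] [CompleteSpace E]
    {δ : ℝ} (hδ : 0 < δ) {y : ℕ → E} (h : IsDeltaSeparated δ y) (j : ℕ) :
    ∃ u : E, ‖u‖ ≤ δ⁻¹ ∧ ∀ i, ⟪u, y i⟫_ℝ = if i = j then 1 else 0 := by
  let K := (Submodule.span ℝ (y '' {i | i ≠ j})).topologicalClosure
  haveI : CompleteSpace K := (Submodule.isClosed_topologicalClosure _).completeSpace_coe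
  have hK : ∀ v ∈ K, δ ≤ ‖y j - v‖ := by
    intro v hv
    refine closure_minimal (s := (Submodule.span ℝ (y '' {i | i ≠ j}) : Set E))
      (t := {v | δ ≤ ‖y j - v‖}) (h j) (isClosed_le (by fun_prop) (by fun_prop)) ?_
    exact hv
  set p := K.starProjection (y j) with hp
  have hpK : p ∈ K := Submodule.starProjection_apply_mem _ _
  have hort : ∀ w ∈ K, ⟪y j - p, w⟫_ℝ = 0 := fun w hw =>
    Submodule.starProjection_inner_eq_zero _ _ hw
  have hd := hK p hpK
  have hpos : 0 < ‖y j - p‖ := hδ.trans_le hd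
  refine ⟨(‖y j - p‖ ^ 2)⁻¹ • (y j - p), ?_, fun i => ?_⟩
  · rw [norm_smul, norm_inv, norm_pow, norm_norm]
    have : (‖y j - p‖ ^ 2)⁻¹ * ‖y j - p‖ = ‖y j - p‖⁻¹ := by field_simp
    rw [this]
    gcongr
  · rw [real_inner_smul_left]
    split_ifs with hij
    · subst hij
      have : ⟪y i - p, y i⟫_ℝ = ‖y i - p‖ ^ 2 := by
        rw [← real_inner_self_eq_norm_sq, inner_sub_right (y i - p), hort p hpK, sub_zero]
      rw [this]; field_simp
    · rw [hort, mul_zero]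
      exact Submodule.le_topologicalClosure _ (Submodule.subset_span ⟨i, hij, rfl⟩)

lemma sep_of_surj {E : Type} [NormedAddCommGroup E] [InnerProductSpace ℝ E] [CompleteSpace E]
    (y : ℕ → E) (h : ∀ a : ℕ → ℝ, (Summable fun k => |a k|) → ∃ u : E, ∀ k, ⟪u, y k⟫_ℝ = a k) :
    ∃ δ : ℝ, 0 < δ ∧ IsDeltaSeparated δ y := by
  let L1 := lp (fun _ : ℕ => ℝ) 1
  let Z : Submodule ℝ (E × L1) :=
    { carrier := {p | ∀ k, ⟪p.1, y k⟫_ℝ = p.2 k}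
      add_mem' := by
        intro p q hp hq k
        have h1 : (p + q).2 k = p.2 k + q.2 k := rfl
        rw [h1, Prod.fst_add, inner_add_left, hp k, hq k]
      zero_mem' := by
        intro k
        exact inner_zero_left _
      smul_mem' := by
        intro c p hp k
        have h1 : (c • p).2 k = c * p.2 k := rfl
        rw [h1, Prod.smul_fst, real_inner_smul_left, hp k] }
  have hZ : IsClosed (Z : Set (E × L1)) := by
    change IsClosed {p : E × L1 | ∀ k, ⟪p.1, y k⟫_ℝ = p.2 k}
    rw [Set.setOf_forall]
    refine isClosed_iInter fun k => isClosed_eq (by fun_prop) ?_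
    exact (lp.lipschitzWith_one_eval 1 k).continuous.comp continuous_snd
  haveI : CompleteSpace Z := hZ.completeSpace_coe
  let π : Z →L[ℝ] L1 := (ContinuousLinearMap.snd ℝ E L1).comp Z.subtypeL
  have hsurj : Function.Surjective π := by
    intro a
    have ha := (lp.hasSum_norm (p := 1) (by norm_num) a).summable
    obtain ⟨u, hu⟩ := h a (by simpa using ha)
    exact ⟨⟨(u, a), hu⟩, rfl⟩
  obtain ⟨C, hC, hpre⟩ := π.exists_preimage_norm_le hsurj
  refine ⟨C⁻¹, inv_pos.2 hC, fun j v hv => ?_⟩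
  obtain ⟨⟨⟨u, a⟩, hz⟩, hza, hn⟩ := hpre (lp.single 1 j (1 : ℝ))
  have hza' : a = lp.single 1 j (1 : ℝ) := hza
  have hu : ∀ k, ⟪u, y k⟫_ℝ = a k := hz
  have hun : ‖u‖ ≤ C := by
    rw [lp.norm_single (by norm_num)] at hn
    refine (norm_fst_le (u, a)).trans ?_
    simpa using hn
  have hv0 : ⟪u, v⟫_ℝ = 0 := by
    induction hv using Submodule.span_induction with
    | mem w hw =>
      obtain ⟨i, hi, rfl⟩ := hw
      have hi' : i ≠ j := hi
      rw [hu, hza']; simp [hi']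
    | zero => exact inner_zero_right _
    | add a b _ _ ha hb => rw [inner_add_right, ha, hb, add_zero]
    | smul c a _ ha => rw [real_inner_smul_right, ha, mul_zero]
  have h1 : ⟪u, y j - v⟫_ℝ = 1 := by
    rw [inner_sub_right, hv0, hu, hza']; simp
  have h2 := real_inner_le_norm u (y j - v)
  rw [h1] at h2
  rw [inv_le_iff_one_le_mul₀' hC]
  exact h2.trans (by gcongr)

/-- Let `{x_k}_{k=1}^∞` be a frame for the real `ℓ₂` and let
`{y_k}` be the corresponding tilde vectors in `H̃` (so `y_k = x̃_k`, i.e.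
`(y_k)_{i,j} = x_{k,i} · x_{k,i+j}`).  Then every measurement sequence
`a ∈ ℓ₁` is realized by some Hilbert–Schmidt self-adjoint operator `T`
(`⟨T x_k, x_k⟩ = a_k` for all `k`) if and only if `{y_k}` is `δ`-separated
for some `δ > 0`. -/
theorem stmt_19 (x : ℕ → ell2)
    (hframe : ∃ A B : ℝ, 0 < A ∧ A ≤ B ∧ ∀ v : ell2,
      A * ‖v‖ ^ 2 ≤ ∑' k, ⟪v, x k⟫_ℝ ^ 2 ∧ ∑' k, ⟪v, x k⟫_ℝ ^ 2 ≤ B * ‖v‖ ^ 2)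
    (y : ℕ → Htilde) (hy : ∀ k i j, y k i j = x k i * x k (i + j)) :
    ((∀ a : ℕ → ℝ, (Summable fun k => |a k|) →
        ∃ T : ell2 →L[ℝ] ell2, IsHilbertSchmidt T ∧ IsSelfAdjoint T ∧
          ∀ k, ⟪T (x k), x k⟫_ℝ = a k) ↔
      (∃ δ : ℝ, 0 < δ ∧ IsDeltaSeparated δ y)) := by
  constructor
  · intro h
    apply sep_of_surj
    intro a ha
    obtain ⟨T, hT, hs, hTa⟩ := h a ha
    obtain ⟨u, hu⟩ := exists_u hT hs
    refine ⟨u, fun k => ?_⟩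
    rw [← Sop_inner u (y k) (x k) (hy k), ← hu, hTa]
  · rintro ⟨δ, hδ, hsep⟩ a ha
    choose u hun hu using exists_dual hδ hsep
    have hsum : Summable fun j => a j • u j := by
      refine Summable.of_norm_bounded (ha.mul_right δ⁻¹) fun j => ?_
      rw [norm_smul]
      exact mul_le_mul_of_nonneg_left (hun j) (norm_nonneg _)
    obtain ⟨T, hT, hs, hTu⟩ := exists_T (∑' j, a j • u j)
    refine ⟨T, hT, hs, fun k => ?_⟩
    rw [hTu, Sop_inner _ (y k) (x k) (hy k)]
    have h1 := hsum.hasSum.mapL (innerSL ℝ (y k))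
    simp only [innerSL_apply_apply, real_inner_smul_right] at h1
    rw [real_inner_comm, ← h1.tsum_eq, tsum_eq_single k]
    · rw [real_inner_comm, hu]; simp
    · intro j hj
      rw [real_inner_comm, hu, if_neg hj.symm, mul_zero]
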